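/- Let μ and ν be Borel probability measures on ℝ with finite second moments, with quantile functions F⁻¹ and G⁻¹. Then for every coupling π of μ and ν, ∫_{ℝ×ℝ} x·y dπ(x,y) ≤ ∫₀¹ F⁻¹(t)·G⁻¹(t) dt. -/

import Mathlib

open MeasureTheory ProbabilityTheory Set

/-- The cumulative distribution function of a Borel measure on `ℝ`. -/
noncomputable def cdfOf (μ : Measure ℝ) : ℝ → ℝ := fun x => (μ (Iic x)).toReal

/-- The quantile function (generalized inverse) of a CDF `G`:
`G⁻¹ t = inf {x : ℝ | t ≤ G x}`. -/
noncomputable def quantileFn (G : ℝ → ℝ) : ℝ → ℝ := fun t => sInf {x : ℝ | t ≤ G x}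

/-- `π` is a coupling of `μ` and `ν`: its first marginal is `μ` and its second marginal is `ν`. -/
def IsCoupling (π : Measure (ℝ × ℝ)) (μ ν : Measure ℝ) : Prop :=
  π.map Prod.fst = μ ∧ π.map Prod.snd = ν

/-- Layer-cake comparison: a product of nonnegative functions has larger integral under the
measure giving larger mass to joint superlevel sets. -/
lemma lintegral_mul_le_of_measure_inter_le {α : Type*} [MeasurableSpace α] {P P' : Measure α}
    {X Y : α → ℝ} (hX : Measurable X) (hY : Measurable Y) (hX0 : ∀ a, 0 ≤ X a)
    (hY0 : ∀ a, 0 ≤ Y a)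
    (h : ∀ s t, 0 < s → 0 < t →
      P ({a | s < X a} ∩ {a | t < Y a}) ≤ P' ({a | s < X a} ∩ {a | t < Y a})) :
    ∫⁻ a, ENNReal.ofReal (X a * Y a) ∂P ≤ ∫⁻ a, ENNReal.ofReal (X a * Y a) ∂P' := by
  have key (Q : Measure α) : ∫⁻ a, ENNReal.ofReal (X a * Y a) ∂Q =
      ∫⁻ s in Ioi (0 : ℝ), ∫⁻ t in Ioi (0 : ℝ), Q ({a | s < X a} ∩ {a | t < Y a}) := by
    have h1 : ∫⁻ a, ENNReal.ofReal (X a * Y a) ∂Q =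
        ∫⁻ a, ENNReal.ofReal (X a) ∂(Q.withDensity fun a => ENNReal.ofReal (Y a)) := by
      rw [lintegral_withDensity_eq_lintegral_mul _ hY.ennreal_ofReal hX.ennreal_ofReal]
      refine lintegral_congr fun a => ?_
      rw [ENNReal.ofReal_mul (hX0 a), Pi.mul_apply, mul_comm]
    rw [h1, lintegral_eq_lintegral_meas_lt _ (ae_of_all _ hX0) hX.aemeasurable]
    refine lintegral_congr fun s => ?_
    rw [withDensity_apply _ (measurableSet_lt measurable_const hX),
      lintegral_eq_lintegral_meas_lt _ (ae_of_all _ hY0) hY.aemeasurable]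
    refine lintegral_congr fun t => ?_
    rw [Measure.restrict_apply (measurableSet_lt measurable_const hY), inter_comm]
  rw [key, key]
  exact setLIntegral_mono' measurableSet_Ioi fun s hs =>
    setLIntegral_mono' measurableSet_Ioi fun t ht => h s t hs ht

lemma integral_mul_le_of_measure_inter_le {α : Type*} [MeasurableSpace α] {P P' : Measure α}
    {X Y : α → ℝ} (hX : Measurable X) (hY : Measurable Y) (hX0 : ∀ a, 0 ≤ X a)
    (hY0 : ∀ a, 0 ≤ Y a) (hint : Integrable (fun a => X a * Y a) P')
    (h : ∀ s t, 0 < s → 0 < t →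
      P ({a | s < X a} ∩ {a | t < Y a}) ≤ P' ({a | s < X a} ∩ {a | t < Y a})) :
    ∫ a, X a * Y a ∂P ≤ ∫ a, X a * Y a ∂P' := by
  have hXY0 (a : α) : 0 ≤ X a * Y a := mul_nonneg (hX0 a) (hY0 a)
  rw [integral_eq_lintegral_of_nonneg_ae (ae_of_all _ hXY0) (hX.mul hY).aestronglyMeasurable,
    integral_eq_lintegral_of_nonneg_ae (ae_of_all _ hXY0) (hX.mul hY).aestronglyMeasurable]
  refine ENNReal.toReal_mono ?_ (lintegral_mul_le_of_measure_inter_le hX hY hX0 hY0 h)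
  exact ((hasFiniteIntegral_iff_ofReal (ae_of_all _ hXY0)).1 hint.2).ne

lemma measure_inter_compl_le_of_measure_inter_le {α : Type*} [MeasurableSpace α]
    {P P' : Measure α} [IsFiniteMeasure P] {S T : Set α} (hT : MeasurableSet T)
    (hS : P S = P' S) (h : P (S ∩ T) ≤ P' (S ∩ T)) : P' (S ∩ Tᶜ) ≤ P (S ∩ Tᶜ) := by
  rw [← sdiff_eq]
  refine (ENNReal.add_le_add_iff_left (measure_ne_top P (S ∩ T))).1 ?_
  rw [measure_inter_add_sdiff S hT, hS, ← measure_inter_add_sdiff S hT]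
  gcongr

lemma IsCoupling.measure_fst_preimage {π : Measure (ℝ × ℝ)} {μ ν : Measure ℝ}
    (hπ : IsCoupling π μ ν) {A : Set ℝ} (hA : MeasurableSet A) : π (Prod.fst ⁻¹' A) = μ A := by
  rw [← hπ.1, Measure.map_apply measurable_fst hA]

lemma IsCoupling.measure_snd_preimage {π : Measure (ℝ × ℝ)} {μ ν : Measure ℝ}
    (hπ : IsCoupling π μ ν) {B : Set ℝ} (hB : MeasurableSet B) : π (Prod.snd ⁻¹' B) = ν B := by
  rw [← hπ.2, Measure.map_apply measurable_snd hB]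

lemma IsCoupling.isProbabilityMeasure {π : Measure (ℝ × ℝ)} {μ ν : Measure ℝ}
    [IsProbabilityMeasure μ] (hπ : IsCoupling π μ ν) : IsProbabilityMeasure π :=
  ⟨by rw [← preimage_univ (f := Prod.fst), hπ.measure_fst_preimage .univ, measure_univ]⟩

lemma IsCoupling.memLp_fst {π : Measure (ℝ × ℝ)} {μ ν : Measure ℝ} (hπ : IsCoupling π μ ν)
    (hμ2 : Integrable (fun x => x ^ 2) μ) : MemLp (fun p : ℝ × ℝ => p.1) 2 π :=
  ((memLp_two_iff_integrable_sq aestronglyMeasurable_id).2 hμ2).comp_measurePreserving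
    ⟨measurable_fst, hπ.1⟩

lemma IsCoupling.memLp_snd {π : Measure (ℝ × ℝ)} {μ ν : Measure ℝ} (hπ : IsCoupling π μ ν)
    (hν2 : Integrable (fun x => x ^ 2) ν) : MemLp (fun p : ℝ × ℝ => p.2) 2 π :=
  ((memLp_two_iff_integrable_sq aestronglyMeasurable_id).2 hν2).comp_measurePreserving
    ⟨measurable_snd, hπ.2⟩

lemma lt_max_neg_zero_iff_mem {s x : ℝ} (hs : 0 < s) : s < max (-x) 0 ↔ x ∈ (Ici (-s))ᶜ := by
  simp [hs.not_gt, lt_neg]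

lemma lt_max_zero_iff_mem {s x : ℝ} (hs : 0 < s) : s < max x 0 ↔ x ∈ Ioi s := by
  simp [hs.not_gt]

lemma integral_mul_eq_posPart_negPart {π : Measure (ℝ × ℝ)}
    (h1 : MemLp (fun p : ℝ × ℝ => p.1) 2 π) (h2 : MemLp (fun p : ℝ × ℝ => p.2) 2 π) :
    ∫ p : ℝ × ℝ, p.1 * p.2 ∂π =
      (∫ p : ℝ × ℝ, max p.1 0 * max p.2 0 ∂π + ∫ p : ℝ × ℝ, max (-p.1) 0 * max (-p.2) 0 ∂π) -
      (∫ p : ℝ × ℝ, max p.1 0 * max (-p.2) 0 ∂π +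
        ∫ p : ℝ × ℝ, max (-p.1) 0 * max p.2 0 ∂π) := by
  have i1 : Integrable (fun p : ℝ × ℝ => max p.1 0 * max p.2 0) π :=
    h1.pos_part.integrable_mul h2.pos_part
  have i2 : Integrable (fun p : ℝ × ℝ => max (-p.1) 0 * max (-p.2) 0) π :=
    h1.neg_part.integrable_mul h2.neg_part
  have i3 : Integrable (fun p : ℝ × ℝ => max p.1 0 * max (-p.2) 0) π :=
    h1.pos_part.integrable_mul h2.neg_part
  have i4 : Integrable (fun p : ℝ × ℝ => max (-p.1) 0 * max p.2 0) π :=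
    h1.neg_part.integrable_mul h2.pos_part
  rw [← integral_add i1 i2, ← integral_add i3 i4]
  refine Eq.trans ?_ (integral_sub (i1.add i2) (i3.add i4))
  refine integral_congr_ae (ae_of_all _ fun p => ?_)
  have hx := max_zero_sub_max_neg_zero_eq_self p.1
  have hy := max_zero_sub_max_neg_zero_eq_self p.2
  beta_reduce
  conv_lhs => rw [← hx, ← hy]
  ring

/-- Among couplings with the same square-integrable marginals, larger mass on products of upper sets
implies larger correlation. -/
lemma IsCoupling.integral_mul_le {π π' : Measure (ℝ × ℝ)} {μ ν : Measure ℝ}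
    [IsProbabilityMeasure μ] (hπ : IsCoupling π μ ν) (hπ' : IsCoupling π' μ ν)
    (hμ2 : Integrable (fun x => x ^ 2) μ) (hν2 : Integrable (fun x => x ^ 2) ν)
    (h : ∀ A B : Set ℝ, IsUpperSet A → IsUpperSet B → MeasurableSet A → MeasurableSet B →
      π (Prod.fst ⁻¹' A ∩ Prod.snd ⁻¹' B) ≤ π' (Prod.fst ⁻¹' A ∩ Prod.snd ⁻¹' B)) :
    ∫ p : ℝ × ℝ, p.1 * p.2 ∂π ≤ ∫ p : ℝ × ℝ, p.1 * p.2 ∂π' := by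
  have := hπ.isProbabilityMeasure
  have := hπ'.isProbabilityMeasure
  have hul : ∀ A B : Set ℝ, IsUpperSet A → IsUpperSet B → MeasurableSet A → MeasurableSet B →
      π' (Prod.fst ⁻¹' A ∩ Prod.snd ⁻¹' Bᶜ) ≤ π (Prod.fst ⁻¹' A ∩ Prod.snd ⁻¹' Bᶜ) :=
    fun A B hA hB mA mB => measure_inter_compl_le_of_measure_inter_le (measurable_snd mB)
      (by rw [hπ.measure_fst_preimage mA, hπ'.measure_fst_preimage mA]) (h A B hA hB mA mB)
  have hlu : ∀ A B : Set ℝ, IsUpperSet A → IsUpperSet B → MeasurableSet A → MeasurableSet B →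
      π' (Prod.fst ⁻¹' Aᶜ ∩ Prod.snd ⁻¹' B) ≤ π (Prod.fst ⁻¹' Aᶜ ∩ Prod.snd ⁻¹' B) := by
    intro A B hA hB mA mB
    have := h A B hA hB mA mB
    rw [inter_comm] at this ⊢
    exact measure_inter_compl_le_of_measure_inter_le (measurable_fst mA)
      (by rw [hπ.measure_snd_preimage mB, hπ'.measure_snd_preimage mB]) this
  have hll : ∀ A B : Set ℝ, IsUpperSet A → IsUpperSet B → MeasurableSet A → MeasurableSet B →
      π (Prod.fst ⁻¹' Aᶜ ∩ Prod.snd ⁻¹' Bᶜ) ≤ π' (Prod.fst ⁻¹' Aᶜ ∩ Prod.snd ⁻¹' Bᶜ) :=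
    fun A B hA hB mA mB => measure_inter_compl_le_of_measure_inter_le (measurable_snd mB)
      (by rw [hπ.measure_fst_preimage mA.compl, hπ'.measure_fst_preimage mA.compl])
      (hlu A B hA hB mA mB)
  have h1 := hπ.memLp_fst hμ2
  have h2 := hπ.memLp_snd hν2
  have h1' := hπ'.memLp_fst hμ2
  have h2' := hπ'.memLp_snd hν2
  have m1 : Measurable fun p : ℝ × ℝ => max p.1 0 := by fun_prop
  have m2 : Measurable fun p : ℝ × ℝ => max p.2 0 := by fun_prop
  have n1 : Measurable fun p : ℝ × ℝ => max (-p.1) 0 := by fun_prop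
  have n2 : Measurable fun p : ℝ × ℝ => max (-p.2) 0 := by fun_prop
  rw [integral_mul_eq_posPart_negPart h1 h2, integral_mul_eq_posPart_negPart h1' h2']
  refine sub_le_sub (add_le_add ?_ ?_) (add_le_add ?_ ?_)
  · refine integral_mul_le_of_measure_inter_le m1 m2 (fun _ => le_max_right _ _)
      (fun _ => le_max_right _ _) (h1'.pos_part.integrable_mul h2'.pos_part) fun s t hs ht => ?_
    simp only [lt_max_zero_iff_mem hs, lt_max_zero_iff_mem ht]
    exact h _ _ (isUpperSet_Ioi s) (isUpperSet_Ioi t) measurableSet_Ioi measurableSet_Ioi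
  · refine integral_mul_le_of_measure_inter_le n1 n2 (fun _ => le_max_right _ _)
      (fun _ => le_max_right _ _) (h1'.neg_part.integrable_mul h2'.neg_part) fun s t hs ht => ?_
    simp only [lt_max_neg_zero_iff_mem hs, lt_max_neg_zero_iff_mem ht]
    exact hll _ _ (isUpperSet_Ici (-s)) (isUpperSet_Ici (-t)) measurableSet_Ici measurableSet_Ici
  · refine integral_mul_le_of_measure_inter_le m1 n2 (fun _ => le_max_right _ _)
      (fun _ => le_max_right _ _) (h1.pos_part.integrable_mul h2.neg_part) fun s t hs ht => ?_
    simp only [lt_max_zero_iff_mem hs, lt_max_neg_zero_iff_mem ht]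
    exact hul _ _ (isUpperSet_Ioi s) (isUpperSet_Ici (-t)) measurableSet_Ioi measurableSet_Ici
  · refine integral_mul_le_of_measure_inter_le n1 m2 (fun _ => le_max_right _ _)
      (fun _ => le_max_right _ _) (h1.neg_part.integrable_mul h2.pos_part) fun s t hs ht => ?_
    simp only [lt_max_neg_zero_iff_mem hs, lt_max_zero_iff_mem ht]
    exact hlu _ _ (isUpperSet_Ici (-s)) (isUpperSet_Ioi t) measurableSet_Ici measurableSet_Ioi

lemma cdfOf_eq_cdf (μ : Measure ℝ) [IsProbabilityMeasure μ] : cdfOf μ = cdf μ := by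
  ext x
  rw [cdf_eq_real, cdfOf, measureReal_def]

/-- The Galois connection between a distribution function and its quantile function. -/
lemma quantileFn_cdfOf_le_iff (μ : Measure ℝ) [IsProbabilityMeasure μ] {t : ℝ}
    (ht : t ∈ Ioo (0 : ℝ) 1) (x : ℝ) : quantileFn (cdfOf μ) t ≤ x ↔ t ≤ cdfOf μ x := by
  rw [cdfOf_eq_cdf, quantileFn]
  set S := {x : ℝ | t ≤ cdf μ x}
  have hne : S.Nonempty := by
    obtain ⟨y, hy⟩ := ((tendsto_cdf_atTop μ).eventually_const_lt ht.2).exists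
    exact ⟨y, hy.le⟩
  have hbdd : BddBelow S := by
    obtain ⟨y, hy⟩ := ((tendsto_cdf_atBot μ).eventually_lt_const ht.1).exists
    exact ⟨y, fun z hz => le_of_not_gt fun hzy =>
      (hy.trans_le hz).not_ge (monotone_cdf μ hzy.le)⟩
  refine ⟨fun h => ?_, fun h => csInf_le hbdd h⟩
  refine ge_of_tendsto (((cdf μ).right_continuous x).mono_left
    (nhdsWithin_mono x Ioi_subset_Ici_self)) (Filter.eventually_of_mem self_mem_nhdsWithin ?_)
  intro y hy
  obtain ⟨z, hz, hzy⟩ := exists_lt_of_csInf_lt hne (h.trans_lt hy)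
  exact le_trans hz (monotone_cdf μ hzy.le)

lemma monotoneOn_quantileFn_cdfOf (μ : Measure ℝ) [IsProbabilityMeasure μ] :
    MonotoneOn (quantileFn (cdfOf μ)) (Ioo 0 1) := fun _ hs _ ht hst =>
  (quantileFn_cdfOf_le_iff μ hs _).2
    (hst.trans ((quantileFn_cdfOf_le_iff μ ht _).1 le_rfl))

lemma aemeasurable_quantileFn_cdfOf (μ : Measure ℝ) [IsProbabilityMeasure μ] :
    AEMeasurable (quantileFn (cdfOf μ)) (volume.restrict (Ioo 0 1)) :=
  aemeasurable_restrict_of_monotoneOn measurableSet_Ioo (monotoneOn_quantileFn_cdfOf μ)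

lemma map_quantileFn_cdfOf (μ : Measure ℝ) [IsProbabilityMeasure μ] :
    (volume.restrict (Ioo (0 : ℝ) 1)).map (quantileFn (cdfOf μ)) = μ := by
  have : IsProbabilityMeasure (volume.restrict (Ioo (0 : ℝ) 1)) := ⟨by simp⟩
  have := Measure.isProbabilityMeasure_map (aemeasurable_quantileFn_cdfOf μ)
  refine Measure.ext_of_Iic _ _ fun x => ?_
  have h0 : 0 ≤ cdfOf μ x := ENNReal.toReal_nonneg
  have h1 : cdfOf μ x ≤ 1 := by rw [cdfOf_eq_cdf]; exact cdf_le_one μ x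
  rw [Measure.map_apply_of_aemeasurable (aemeasurable_quantileFn_cdfOf μ) measurableSet_Iic,
    Measure.restrict_apply' measurableSet_Ioo]
  have : quantileFn (cdfOf μ) ⁻¹' Iic x ∩ Ioo 0 1 = Iic (cdfOf μ x) ∩ Ioo 0 1 := by
    ext t
    exact and_congr_left fun ht => quantileFn_cdfOf_le_iff μ ht x
  rw [this, ← Measure.restrict_apply' measurableSet_Ioo,
    Measure.restrict_congr_set Ioo_ae_eq_Ioc, Measure.restrict_apply' measurableSet_Ioc,
    inter_comm, Ioc_inter_Iic, min_eq_right h1, Real.volume_Ioc, sub_zero, cdfOf,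
    ENNReal.ofReal_toReal (measure_ne_top _ _)]

/-- The monotone quantile coupling of two measures on `ℝ`. -/
noncomputable def quantileCoupling (μ ν : Measure ℝ) : Measure (ℝ × ℝ) :=
  (volume.restrict (Ioo (0 : ℝ) 1)).map
    fun t => (quantileFn (cdfOf μ) t, quantileFn (cdfOf ν) t)

lemma isCoupling_quantileCoupling (μ ν : Measure ℝ) [IsProbabilityMeasure μ]
    [IsProbabilityMeasure ν] : IsCoupling (quantileCoupling μ ν) μ ν := by
  have hm := (aemeasurable_quantileFn_cdfOf μ).prodMk (aemeasurable_quantileFn_cdfOf ν)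
  constructor
  · rw [quantileCoupling, AEMeasurable.map_map_of_aemeasurable measurable_fst.aemeasurable hm]
    exact map_quantileFn_cdfOf μ
  · rw [quantileCoupling, AEMeasurable.map_map_of_aemeasurable measurable_snd.aemeasurable hm]
    exact map_quantileFn_cdfOf ν

/-- The quantile coupling attains the Fréchet upper bound on products of upper sets. -/
lemma min_le_quantileCoupling (μ ν : Measure ℝ) [IsProbabilityMeasure μ]
    [IsProbabilityMeasure ν] {A B : Set ℝ} (hA : IsUpperSet A) (hB : IsUpperSet B)
    (mA : MeasurableSet A) (mB : MeasurableSet B) :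
    min (μ A) (ν B) ≤ quantileCoupling μ ν (Prod.fst ⁻¹' A ∩ Prod.snd ⁻¹' B) := by
  have hμ := aemeasurable_quantileFn_cdfOf μ
  have hν := aemeasurable_quantileFn_cdfOf ν
  have eμ : μ A = volume (quantileFn (cdfOf μ) ⁻¹' A ∩ Ioo 0 1) := by
    conv_lhs => rw [← map_quantileFn_cdfOf μ]
    rw [Measure.map_apply_of_aemeasurable hμ mA, Measure.restrict_apply' measurableSet_Ioo]
  have eν : ν B = volume (quantileFn (cdfOf ν) ⁻¹' B ∩ Ioo 0 1) := by
    conv_lhs => rw [← map_quantileFn_cdfOf ν]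
    rw [Measure.map_apply_of_aemeasurable hν mB, Measure.restrict_apply' measurableSet_Ioo]
  rw [quantileCoupling, Measure.map_apply_of_aemeasurable (hμ.prodMk hν)
    ((measurable_fst mA).inter (measurable_snd mB)), Measure.restrict_apply' measurableSet_Ioo,
    eμ, eν]
  by_cases hsub : quantileFn (cdfOf μ) ⁻¹' A ∩ Ioo 0 1 ⊆ quantileFn (cdfOf ν) ⁻¹' B
  · exact (min_le_left _ _).trans (measure_mono fun t ht => ⟨⟨ht.1, hsub ht⟩, ht.2⟩)
  · obtain ⟨s, hs, hsB⟩ := not_subset.1 hsub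
    refine (min_le_right _ _).trans (measure_mono fun t ht => ⟨⟨?_, ht.1⟩, ht.2⟩)
    have hst : s ≤ t := le_of_not_ge fun hts =>
      hsB (hB (monotoneOn_quantileFn_cdfOf ν ht.2 hs.2 hts) ht.1)
    exact hA (monotoneOn_quantileFn_cdfOf μ hs.2 ht.2 hst) hs.1

/-- For Borel probability measures `μ, ν` on `ℝ` with finite second moments,
every coupling `π` of `μ` and `ν` satisfies `∫ x·y dπ(x,y) ≤ ∫₀¹ F⁻¹(t)·G⁻¹(t) dt`
(a Hardy–Littlewood-type correlation inequality). -/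
theorem coupling_correlation_le_quantile_correlation
    (μ ν : Measure ℝ) [IsProbabilityMeasure μ] [IsProbabilityMeasure ν]
    (hμ2 : Integrable (fun x => x ^ 2) μ) (hν2 : Integrable (fun x => x ^ 2) ν)
    (π : Measure (ℝ × ℝ)) (hπ : IsCoupling π μ ν) :
    ∫ p : ℝ × ℝ, p.1 * p.2 ∂π ≤
      ∫ t in (0:ℝ)..1, quantileFn (cdfOf μ) t * quantileFn (cdfOf ν) t := by
  have hm := (aemeasurable_quantileFn_cdfOf μ).prodMk (aemeasurable_quantileFn_cdfOf ν)
  have hq : ∫ p : ℝ × ℝ, p.1 * p.2 ∂(quantileCoupling μ ν) =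
      ∫ t in (0:ℝ)..1, quantileFn (cdfOf μ) t * quantileFn (cdfOf ν) t := by
    rw [intervalIntegral.integral_of_le zero_le_one, integral_Ioc_eq_integral_Ioo,
      quantileCoupling, integral_map hm (by fun_prop)]
  rw [← hq]
  refine hπ.integral_mul_le (isCoupling_quantileCoupling μ ν) hμ2 hν2
    fun A B hA hB mA mB => le_trans (le_min ?_ ?_) (min_le_quantileCoupling μ ν hA hB mA mB)
  · exact (measure_mono inter_subset_left).trans_eq (hπ.measure_fst_preimage mA)
  · exact (measure_mono inter_subset_right).trans_eq (hπ.measure_snd_preimage mB)
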